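/- In the isthmus setting with generic parameters, at every critical point (x,λ₀) of D (necessarily with x a corner point) one has ∂²D/∂z_i∂z_j(x,λ₀) = 0 for all i ≠ j and ∂²D/∂z_j²(x,λ₀) = 2·x_j⁻³·E_j·P_{f(j)}(x,λ₀)·Q_{f(j)}(x,λ₀) ≠ 0 for every j; hence the Hessian matrix (∂²D/∂z_i∂z_j(x,λ₀))_{i,j} is an invertible diagonal matrix and (x,λ₀) is a nondegenerate critical point. -/

import Mathlib

/-- The principal minor: determinant of the submatrix of `N` on rows and columns of index
`< s` (equal to `1` when `s = 0`). -/
noncomputable def Pminor {n : ℕ} (N : Matrix (Fin n) (Fin n) ℂ) (s : ℕ) : ℂ :=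
  (N.submatrix (fun i : Fin (min s n) => Fin.castLE (min_le_right s n) i)
    (fun i : Fin (min s n) => Fin.castLE (min_le_right s n) i)).det

/-- The co-principal minor: determinant of the submatrix of `N` on rows and columns of index
`> s` (equal to `1` when `s = n − 1`). -/
noncomputable def Qminor {n : ℕ} (N : Matrix (Fin n) (Fin n) ℂ) (s : ℕ) : ℂ :=
  (N.submatrix (fun i : Fin (n - 1 - s) => (⟨s + 1 + i.1, by have := i.2; omega⟩ : Fin n))
    (fun i : Fin (n - 1 - s) => (⟨s + 1 + i.1, by have := i.2; omega⟩ : Fin n))).det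

/-- The Floquet matrix of a periodic isthmus-connected graph: the matrix `M` with
`E_j·(z_j + z_j⁻¹)` added to the diagonal entry `(f j, f j)` for each `j`. -/
noncomputable def isthH (a m b d : ℕ) (M : Matrix (Fin (a + m + b)) (Fin (a + m + b)) ℝ)
    (f : Fin d → Fin (a + m + b)) (E : Fin d → ℝ) (z : Fin d → ℂ) :
    Matrix (Fin (a + m + b)) (Fin (a + m + b)) ℂ :=
  Matrix.of fun i i' => (M i i' : ℂ) +
    if i = i' then ∑ j, (if f j = i then (E j : ℂ) * (z j + (z j)⁻¹) else 0) else 0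

/-- The dispersion polynomial `D(z,λ) = det(H(z) − λ·I)`. -/
noncomputable def isthD (a m b d : ℕ) (M : Matrix (Fin (a + m + b)) (Fin (a + m + b)) ℝ)
    (f : Fin d → Fin (a + m + b)) (E : Fin d → ℝ) (z : Fin d → ℂ) (lam : ℂ) : ℂ :=
  (isthH a m b d M f E z - lam • 1).det

/-- `P_s(z,λ)`: the principal minor of `H(z) − λ·I` on indices `< s`. -/
noncomputable def isthP (a m b d : ℕ) (M : Matrix (Fin (a + m + b)) (Fin (a + m + b)) ℝ)
    (f : Fin d → Fin (a + m + b)) (E : Fin d → ℝ) (s : ℕ) (z : Fin d → ℂ) (lam : ℂ) : ℂ :=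
  Pminor (isthH a m b d M f E z - lam • 1) s

/-- `Q_s(z,λ)`: the co-principal minor of `H(z) − λ·I` on indices `> s`. -/
noncomputable def isthQ (a m b d : ℕ) (M : Matrix (Fin (a + m + b)) (Fin (a + m + b)) ℝ)
    (f : Fin d → Fin (a + m + b)) (E : Fin d → ℝ) (s : ℕ) (z : Fin d → ℂ) (lam : ℂ) : ℂ :=
  Qminor (isthH a m b d M f E z - lam • 1) s

/-- The partial derivative `∂D/∂z_j`. -/
noncomputable def isthPD (a m b d : ℕ) (M : Matrix (Fin (a + m + b)) (Fin (a + m + b)) ℝ)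
    (f : Fin d → Fin (a + m + b)) (E : Fin d → ℝ) (j : Fin d) (z : Fin d → ℂ) (lam : ℂ) : ℂ :=
  deriv (fun t => isthD a m b d M f E (Function.update z j t) lam) (z j)

/-- The second partial derivative `∂²D/∂z_j∂z_i`. -/
noncomputable def isthPD2 (a m b d : ℕ) (M : Matrix (Fin (a + m + b)) (Fin (a + m + b)) ℝ)
    (f : Fin d → Fin (a + m + b)) (E : Fin d → ℝ) (i j : Fin d) (z : Fin d → ℂ) (lam : ℂ) : ℂ :=
  deriv (fun s => isthPD a m b d M f E i (Function.update z j s) lam) (z j)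

section MaskedMinors

open Finset Matrix

variable {ι R : Type*} [DecidableEq ι] [CommRing R]

/-- The matrix agreeing with `N` on `S × S` and with the identity elsewhere. -/
def maskMatrix (N : Matrix ι ι R) (S : Finset ι) : Matrix ι ι R :=
  Matrix.of fun i j => if i ∈ S ∧ j ∈ S then N i j else if i = j then 1 else 0

lemma maskMatrix_maskMatrix (N : Matrix ι ι R) (S T : Finset ι) :
    maskMatrix (maskMatrix N S) T = maskMatrix N (S ∩ T) := by
  ext i j
  simp only [maskMatrix, Matrix.of_apply, Finset.mem_inter]
  split_ifs <;> tauto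

variable [Fintype ι]

/-- The principal minor of `N` on the index set `S`, as the determinant of a masked matrix. -/
def maskDet (N : Matrix ι ι R) (S : Finset ι) : R := (maskMatrix N S).det

lemma maskDet_maskMatrix (N : Matrix ι ι R) (S T : Finset ι) :
    maskDet (maskMatrix N S) T = maskDet N (S ∩ T) := by
  rw [maskDet, maskMatrix_maskMatrix, maskDet]

lemma maskDet_univ (N : Matrix ι ι R) : maskDet N univ = N.det := by
  rw [maskDet]
  congr 1
  ext i j
  simp [maskMatrix]

lemma maskDet_empty (N : Matrix ι ι R) : maskDet N ∅ = 1 := by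
  have h : maskMatrix N ∅ = 1 := by
    ext i j
    simp [maskMatrix, Matrix.one_apply]
  rw [maskDet, h, Matrix.det_one]

lemma maskDet_singleton (N : Matrix ι ι R) (k : ι) : maskDet N {k} = N k k := by
  have h : maskMatrix N {k} = Matrix.diagonal (Function.update 1 k (N k k)) := by
    ext i j
    by_cases hi : i = k <;> by_cases hj : j = k <;> by_cases hij : i = j <;>
      simp_all [maskMatrix]
  rw [maskDet, h, Matrix.det_diagonal, Finset.prod_update_of_mem (mem_univ k)]
  simp

lemma maskDet_eq_det_toSquareBlockProp (N : Matrix ι ι R) (S : Finset ι)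
    [Fintype {i // i ∈ S}] [DecidableEq {i // i ∈ S}] :
    maskDet N S = (toSquareBlockProp N (· ∈ S)).det := by
  rw [maskDet, Matrix.twoBlockTriangular_det _ (· ∈ S)]
  · have h1 : toSquareBlockProp (maskMatrix N S) (· ∈ S) = toSquareBlockProp N (· ∈ S) := by
      ext i j
      simp [maskMatrix, toSquareBlockProp, i.2, j.2]
    have h2 : toSquareBlockProp (maskMatrix N S) (fun i => ¬ i ∈ S) = 1 := by
      ext i j
      simp [maskMatrix, toSquareBlockProp, i.2, Matrix.one_apply, Subtype.ext_iff]
    rw [h1, h2, Matrix.det_one, mul_one]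
    congr!
  · intro i hi j hj
    have : i ≠ j := fun h => hi (h ▸ hj)
    simp [maskMatrix, hi, this]

lemma maskDet_eq_det_submatrix {κ : Type*} [Fintype κ] [DecidableEq κ] (N : Matrix ι ι R)
    (S : Finset ι) (e : κ → ι) (he : Function.Injective e) (hS : ∀ i, i ∈ S ↔ ∃ k, e k = i) :
    maskDet N S = (N.submatrix e e).det := by
  rw [maskDet_eq_det_toSquareBlockProp]
  let e' : κ ≃ {i // i ∈ S} := Equiv.ofBijective (fun k => ⟨e k, (hS _).2 ⟨k, rfl⟩⟩)
    ⟨fun k l h => he (congrArg Subtype.val h), fun i => by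
      obtain ⟨k, hk⟩ := (hS _).1 i.2
      exact ⟨k, Subtype.ext hk⟩⟩
  rw [← Matrix.det_submatrix_equiv_self e']
  rfl

lemma det_eq_maskDet_mul_of_lower_zero (N : Matrix ι ι R) (S : Finset ι)
    (h : ∀ i, i ∉ S → ∀ j, j ∈ S → N i j = 0) :
    N.det = maskDet N S * maskDet N Sᶜ := by
  rw [Matrix.twoBlockTriangular_det N (· ∈ S) h, maskDet_eq_det_toSquareBlockProp,
    maskDet_eq_det_submatrix N Sᶜ (Subtype.val : {i // ¬ i ∈ S} → ι) Subtype.val_injective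
      (by simp)]
  congr!

lemma det_eq_maskDet_mul_of_upper_zero (N : Matrix ι ι R) (S : Finset ι)
    (h : ∀ i, i ∈ S → ∀ j, j ∉ S → N i j = 0) :
    N.det = maskDet N S * maskDet N Sᶜ := by
  rw [det_eq_maskDet_mul_of_lower_zero N Sᶜ (fun i hi j hj => h i (by simpa using hi) j
    (by simpa using hj)), compl_compl, mul_comm]

lemma maskDet_union (N : Matrix ι ι R) (S T : Finset ι) (hST : Disjoint S T)
    (h : ∀ i, i ∈ S → ∀ j, j ∈ T → N i j = 0) :
    maskDet N (S ∪ T) = maskDet N S * maskDet N T := by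
  have hd : ∀ i, i ∈ S → i ∉ T := fun i hi hi' => Finset.disjoint_left.1 hST hi hi'
  rw [maskDet, det_eq_maskDet_mul_of_upper_zero _ S, maskDet_maskMatrix, maskDet_maskMatrix]
  · congr 2
    · ext i; simp
    · ext i; have := hd i; simp; tauto
  · intro i hi j hj
    have hij : i ≠ j := fun e => hj (e ▸ hi)
    simp only [maskMatrix, Matrix.of_apply, mem_union, hi, hj, hij]
    simpa using h i hi j

lemma det_updateRow_single_self (N : Matrix ι ι R) (k : ι) (c : R) :
    (N.updateRow k (Pi.single k c)).det = c * maskDet N {k}ᶜ := by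
  rw [det_eq_maskDet_mul_of_upper_zero _ {k}, maskDet_singleton]
  · congr 1
    · simp
    · rw [maskDet, maskDet]
      congr 1
      ext i j
      by_cases hi : i = k
      · subst hi; simp [maskMatrix]
      · simp [maskMatrix, Matrix.updateRow_ne hi]
  · intro i hi j hj
    simp only [mem_singleton] at hi hj
    simp [hi, hj]

/-- The determinant is affine in a diagonal entry. -/
lemma det_add_diagonal_entry (N : Matrix ι ι R) (k : ι) (c : R) :
    (N + Matrix.diagonal (Pi.single k c)).det = N.det + c * maskDet N {k}ᶜ := by
  have h : N + Matrix.diagonal (Pi.single k c) = N.updateRow k (N k + Pi.single k c) := by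
    ext i j
    by_cases hi : i = k
    · subst hi
      by_cases hj : j = i
      · subst hj; simp
      · simp [hj, Matrix.diagonal_apply_ne _ (Ne.symm hj)]
    · by_cases hij : i = j
      · subst hij; simp [hi]
      · simp [hi, hij]
  rw [h, Matrix.det_updateRow_add, Matrix.updateRow_eq_self, det_updateRow_single_self]

/-- Expansion of a determinant along a bridge `u — v` between `S` and its complement. -/
lemma det_eq_of_bridge (N : Matrix ι ι R) (S : Finset ι) (u v : ι) (hu : u ∈ S) (hv : v ∉ S)
    (h : ∀ i j, i ∈ S → j ∉ S → (i = u ∧ j = v) ∨ (N i j = 0 ∧ N j i = 0)) :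
    N.det = maskDet N S * maskDet N Sᶜ
      - N u v * N v u * (maskDet N (S.erase u) * maskDet N (Sᶜ.erase v)) := by
  have huv : u ≠ v := fun e => hv (e ▸ hu)
  set r : ι → R := fun j => if j ∈ S then N u j else 0 with hr
  have hrow : N u = r + Pi.single v (N u v) := by
    ext j
    by_cases hj : j ∈ S
    · have : j ≠ v := fun e => hv (e ▸ hj)
      simp [hr, hj, this]
    · by_cases hjv : j = v
      · subst hjv; simp [hr, hj]
      · rcases h u j hu hj with h' | h'
        · exact absurd h'.2 hjv
        · simp [hr, hj, hjv, h'.1]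
  have hsplit : N.det = (N.updateRow u r).det
      + (N.updateRow u (Pi.single v (N u v))).det := by
    rw [← Matrix.det_updateRow_add, ← hrow, Matrix.updateRow_eq_self]
  have hfirst : (N.updateRow u r).det = maskDet N S * maskDet N Sᶜ := by
    rw [det_eq_maskDet_mul_of_upper_zero _ S]
    · congr 1
      · rw [maskDet, maskDet]
        congr 1
        ext i j
        by_cases hi : i = u
        · subst hi; by_cases hj : j ∈ S <;> simp [maskMatrix, hr, hj]
        · simp [maskMatrix, hi]
      · rw [maskDet, maskDet]
        congr 1
        ext i j
        by_cases hi : i = u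
        · subst hi; simp [maskMatrix, hu]
        · simp [maskMatrix, hi]
    · intro i hi j hj
      by_cases hiu : i = u
      · subst hiu; simp [hr, hj]
      · rcases h i j hi hj with h' | h'
        · exact absurd h'.1 hiu
        · simp [hiu, h'.1]
  set N₂ := N.updateRow u (Pi.single v (N u v)) with hN₂
  set N₃ := N₂.submatrix (Equiv.swap u v) id with hN₃
  have hu₃ : N₃ u = N v := by
    ext j; simp [hN₃, hN₂, huv.symm]
  have hv₃ : N₃ v = Pi.single v (N u v) := by
    ext j; simp [hN₃, hN₂]
  have ho₃ : ∀ i, i ≠ u → i ≠ v → N₃ i = N i := by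
    intro i hi hi'
    ext j; simp [hN₃, hN₂, Equiv.swap_apply_of_ne_of_ne hi hi', hi]
  have hdet₃ : N₂.det = - N₃.det := by
    rw [hN₃, Matrix.det_permute, Equiv.Perm.sign_swap huv]
    simp
  have hS : maskMatrix N₃ S = (maskMatrix N S).updateRow u (Pi.single u (N v u)) := by
    ext i j
    by_cases hi : i = u
    · subst hi
      by_cases hj : j ∈ S
      · by_cases hju : j = i
        · subst hju; simp [maskMatrix, hu, hu₃]
        · rcases h j v hj hv with h' | h'
          · exact absurd h'.1 hju
          · simp [maskMatrix, hu, hu₃, hj, hju, h'.2]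
      · have : j ≠ i := fun e => hj (e ▸ hu)
        simp [maskMatrix, hj, this, this.symm]
    · by_cases hiS : i ∈ S
      · have hiv : i ≠ v := fun e => hv (e ▸ hiS)
        simp [maskMatrix, hi, ho₃ i hi hiv]
      · simp [maskMatrix, hi, hiS]
  have hSc : maskMatrix N₃ Sᶜ = (maskMatrix N Sᶜ).updateRow v (Pi.single v (N u v)) := by
    ext i j
    by_cases hi : i = v
    · subst hi
      by_cases hj : j ∈ S
      · have : j ≠ i := fun e => hv (e ▸ hj)
        simp [maskMatrix, hj, this, this.symm]
      · simp [maskMatrix, hj, hv, hv₃]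
    · by_cases hiS : i ∈ S
      · simp [maskMatrix, hi, hiS]
      · have hiu : i ≠ u := fun e => hiS (e ▸ hu)
        simp [maskMatrix, hi, ho₃ i hiu hi]
  have hsecond : N₃.det =
      (N v u * maskDet N (S.erase u)) * (N u v * maskDet N (Sᶜ.erase v)) := by
    rw [det_eq_maskDet_mul_of_lower_zero _ S]
    · rw [maskDet, maskDet, hS, hSc, det_updateRow_single_self, det_updateRow_single_self,
        maskDet_maskMatrix, maskDet_maskMatrix, ← Finset.sdiff_eq_inter_compl,
        ← Finset.sdiff_eq_inter_compl, Finset.sdiff_singleton_eq_erase,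
        Finset.sdiff_singleton_eq_erase]
    · intro i hi j hj
      have hiu : i ≠ u := fun e => hi (e ▸ hu)
      by_cases hiv : i = v
      · have : j ≠ v := fun e => hv (e ▸ hj)
        subst hiv; simp [hv₃, this]
      · rw [ho₃ i hiu hiv]
        rcases h j i hj hi with h' | h'
        · exact absurd h'.2 hiv
        · exact h'.2
  rw [hsplit, hfirst, hdet₃, hsecond]
  ring

lemma maskDet_union_of_bridge (N : Matrix ι ι R) (S T : Finset ι) (hST : Disjoint S T) (u v : ι)
    (hu : u ∈ S) (hv : v ∈ T)
    (h : ∀ i j, i ∈ S → j ∈ T → (i = u ∧ j = v) ∨ (N i j = 0 ∧ N j i = 0)) :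
    maskDet N (S ∪ T) = maskDet N S * maskDet N T
      - N u v * N v u * (maskDet N (S.erase u) * maskDet N (T.erase v)) := by
  have hd : ∀ i, i ∈ S → i ∉ T := fun i hi hi' => Finset.disjoint_left.1 hST hi hi'
  have hvS : v ∉ S := fun hv' => hd v hv' hv
  have e1 : (S ∪ T) ∩ S = S := by ext i; simp
  have e2 : (S ∪ T) ∩ Sᶜ = T := by ext i; have := hd i; simp; tauto
  have e3 : (S ∪ T) ∩ S.erase u = S.erase u := by ext i; simp; tauto
  have e4 : (S ∪ T) ∩ Sᶜ.erase v = T.erase v := by ext i; have := hd i; simp; tauto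
  rw [maskDet, det_eq_of_bridge _ S u v hu hvS]
  · simp only [maskDet_maskMatrix, e1, e2, e3, e4]
    simp [maskMatrix, hu, hv]
  · intro i j hi hj
    have hij : i ≠ j := fun e => hj (e ▸ hi)
    by_cases hjT : j ∈ T
    · rcases h i j hi hjT with h' | h'
      · exact Or.inl h'
      · exact Or.inr (by simp [maskMatrix, hi, hjT, h'])
    · exact Or.inr (by simp [maskMatrix, hj, hjT, hij, hij.symm])

end MaskedMinors

section Chains

open Finset Matrix

variable {n : ℕ} {R : Type*} [CommRing R]

/-- The leading principal minor on indices `< s`. -/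
def leadMinor (N : Matrix (Fin n) (Fin n) R) (s : ℕ) : R :=
  maskDet N (univ.filter fun i => i.val < s)

/-- The trailing principal minor on indices `≥ s`. -/
def trailMinor (N : Matrix (Fin n) (Fin n) R) (s : ℕ) : R :=
  maskDet N (univ.filter fun i => s ≤ i.val)

/-- The only entries of `N` linking indices `< s` to indices `≥ s` are those at
`(s - 1, s)` and `(s, s - 1)`. -/
def CutAt (N : Matrix (Fin n) (Fin n) R) (s : ℕ) : Prop :=
  ∀ i j : Fin n, i.val < s → s ≤ j.val → (i.val + 1 = s ∧ j.val = s) ∨ (N i j = 0 ∧ N j i = 0)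

lemma leadMinor_zero (N : Matrix (Fin n) (Fin n) R) : leadMinor N 0 = 1 := by
  simp [leadMinor, maskDet_empty]

lemma leadMinor_self (N : Matrix (Fin n) (Fin n) R) : leadMinor N n = N.det := by
  simp [leadMinor, maskDet_univ]

lemma trailMinor_zero (N : Matrix (Fin n) (Fin n) R) : trailMinor N 0 = N.det := by
  simp [trailMinor, maskDet_univ]

lemma trailMinor_self (N : Matrix (Fin n) (Fin n) R) : trailMinor N n = 1 := by
  have e : (univ.filter fun i : Fin n => n ≤ i.val) = ∅ := by
    ext i; simp
  rw [trailMinor, e, maskDet_empty]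

lemma Pminor_eq_leadMinor (N : Matrix (Fin n) (Fin n) ℂ) (s : ℕ) :
    Pminor N s = leadMinor N s := by
  rw [leadMinor, maskDet_eq_det_submatrix N _
    (fun i : Fin (min s n) => Fin.castLE (min_le_right s n) i) (Fin.castLE_injective _), Pminor]
  intro i
  simp only [mem_filter, mem_univ, true_and]
  constructor
  · intro hi
    exact ⟨⟨i.val, lt_min hi i.2⟩, rfl⟩
  · rintro ⟨k, rfl⟩
    exact lt_of_lt_of_le k.2 (min_le_left _ _)

lemma Qminor_eq_trailMinor (N : Matrix (Fin n) (Fin n) ℂ) (s : ℕ) :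
    Qminor N s = trailMinor N (s + 1) := by
  rw [trailMinor, maskDet_eq_det_submatrix N _
    (fun i : Fin (n - 1 - s) => (⟨s + 1 + i.1, by have := i.2; omega⟩ : Fin n)), Qminor]
  · intro i j hij
    ext
    simpa using hij
  · intro i
    simp only [mem_filter, mem_univ, true_and]
    constructor
    · intro hi
      exact ⟨⟨i.val - (s + 1), by omega⟩, by ext; simp; omega⟩
    · rintro ⟨k, rfl⟩
      simp

lemma maskDet_compl_singleton_of_cutAt (N : Matrix (Fin n) (Fin n) R) (k : Fin n)
    (h : CutAt N k.val) :
    maskDet N {k}ᶜ = leadMinor N k.val * trailMinor N (k.val + 1) := by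
  have e : ({k}ᶜ : Finset (Fin n)) =
      (univ.filter fun i => i.val < k.val) ∪ (univ.filter fun i => k.val + 1 ≤ i.val) := by
    ext i
    simp [Fin.ext_iff]
  rw [e, maskDet_union]
  · rfl
  · rw [Finset.disjoint_left]
    intro i
    simp
    omega
  · intro i hi j hj
    simp only [mem_filter, mem_univ, true_and] at hi hj
    rcases h i j hi (by omega) with h' | h'
    · omega
    · exact h'.1

/-- Expansion along the cut edge `(s, s + 1)` inside the window `[p, q)`. -/
lemma maskDet_window_of_cutAt (N : Matrix (Fin n) (Fin n) R) (p q s : ℕ) (hp : p ≤ s)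
    (hq : s + 1 < q) (hs : s + 1 < n) (h : CutAt N (s + 1)) :
    maskDet N (univ.filter fun i => p ≤ i.val ∧ i.val < q)
      = maskDet N (univ.filter fun i => p ≤ i.val ∧ i.val < s + 1)
          * maskDet N (univ.filter fun i => s + 1 ≤ i.val ∧ i.val < q)
        - N ⟨s, by omega⟩ ⟨s + 1, hs⟩ * N ⟨s + 1, hs⟩ ⟨s, by omega⟩
          * (maskDet N (univ.filter fun i => p ≤ i.val ∧ i.val < s)
            * maskDet N (univ.filter fun i => s + 2 ≤ i.val ∧ i.val < q)) := by
  have e : (univ.filter fun i : Fin n => p ≤ i.val ∧ i.val < q) =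
      (univ.filter fun i => p ≤ i.val ∧ i.val < s + 1) ∪
      (univ.filter fun i => s + 1 ≤ i.val ∧ i.val < q) := by
    ext i; simp; omega
  have e1 : (univ.filter fun i : Fin n => p ≤ i.val ∧ i.val < s) =
      (univ.filter fun i : Fin n => p ≤ i.val ∧ i.val < s + 1).erase ⟨s, by omega⟩ := by
    ext i; simp [Fin.ext_iff]; omega
  have e2 : (univ.filter fun i : Fin n => s + 2 ≤ i.val ∧ i.val < q) =
      (univ.filter fun i : Fin n => s + 1 ≤ i.val ∧ i.val < q).erase ⟨s + 1, hs⟩ := by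
    ext i; simp [Fin.ext_iff]; omega
  rw [e, e1, e2]
  apply maskDet_union_of_bridge
  · rw [Finset.disjoint_left]
    intro i
    simp
    omega
  · simp; omega
  · simp; omega
  · intro i j hi hj
    simp only [mem_filter, mem_univ, true_and] at hi hj
    rcases h i j hi.2 hj.1 with h' | h'
    · left
      constructor
      · ext; simp; omega
      · ext; simp; omega
    · exact Or.inr h'

lemma det_eq_of_cutAt (N : Matrix (Fin n) (Fin n) R) (s : ℕ) (hs : s + 1 < n)
    (h : CutAt N (s + 1)) :
    N.det = leadMinor N (s + 1) * trailMinor N (s + 1)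
        - N ⟨s, by omega⟩ ⟨s + 1, hs⟩ * N ⟨s + 1, hs⟩ ⟨s, by omega⟩
          * (leadMinor N s * trailMinor N (s + 2)) := by
  have := maskDet_window_of_cutAt N 0 n s (by omega) (by omega) hs h
  simpa [leadMinor, trailMinor, maskDet_univ] using this

lemma leadMinor_add_two (N : Matrix (Fin n) (Fin n) R) (s : ℕ) (hs : s + 1 < n)
    (h : CutAt N (s + 1)) :
    leadMinor N (s + 2) = leadMinor N (s + 1) * N ⟨s + 1, hs⟩ ⟨s + 1, hs⟩
        - N ⟨s, by omega⟩ ⟨s + 1, hs⟩ * N ⟨s + 1, hs⟩ ⟨s, by omega⟩ * leadMinor N s := by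
  have key := maskDet_window_of_cutAt N 0 (s + 2) s (by omega) (by omega) hs h
  have e1 : (univ.filter fun i : Fin n => s + 1 ≤ i.val ∧ i.val < s + 2) = {⟨s + 1, hs⟩} := by
    ext i; simp [Fin.ext_iff]; omega
  have e2 : (univ.filter fun i : Fin n => s + 2 ≤ i.val ∧ i.val < s + 2) = ∅ := by
    ext i; simp
  rw [e1, e2, maskDet_singleton, maskDet_empty] at key
  simpa [leadMinor] using key

lemma trailMinor_of_cutAt (N : Matrix (Fin n) (Fin n) R) (s : ℕ) (hs : s + 1 < n)
    (h : CutAt N (s + 1)) :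
    trailMinor N s = N ⟨s, by omega⟩ ⟨s, by omega⟩ * trailMinor N (s + 1)
        - N ⟨s, by omega⟩ ⟨s + 1, hs⟩ * N ⟨s + 1, hs⟩ ⟨s, by omega⟩ * trailMinor N (s + 2) := by
  have key := maskDet_window_of_cutAt N s n s le_rfl (by omega) hs h
  have e1 : (univ.filter fun i : Fin n => s ≤ i.val ∧ i.val < s + 1) =
      {⟨s, by omega⟩} := by
    ext i; simp [Fin.ext_iff]; omega
  have e2 : (univ.filter fun i : Fin n => s ≤ i.val ∧ i.val < s) = ∅ := by
    ext i; simp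
  rw [e1, e2, maskDet_singleton, maskDet_empty] at key
  simpa [trailMinor] using key

/-- On a chain of cut edges with nonzero weights, consecutive leading minors do not vanish
simultaneously, provided this holds at the start of the chain. -/
lemma leadMinor_consecutive [IsDomain R] (N : Matrix (Fin n) (Fin n) R) (p q : ℕ)
    (hcut : ∀ s, p ≤ s → s ≤ q → CutAt N s)
    (hne : ∀ s, p ≤ s + 1 → s + 1 ≤ q → ∀ h : s + 1 < n,
      N ⟨s, by omega⟩ ⟨s + 1, h⟩ * N ⟨s + 1, h⟩ ⟨s, by omega⟩ ≠ 0)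
    (h0 : 0 < p → ¬(leadMinor N (p - 1) = 0 ∧ leadMinor N p = 0)) (s : ℕ) (hp : p ≤ s + 1)
    (hq : s + 1 ≤ q) (hn : s + 1 ≤ n) :
    ¬(leadMinor N s = 0 ∧ leadMinor N (s + 1) = 0) := by
  induction s with
  | zero =>
    rw [leadMinor_zero]
    simp
  | succ s ih =>
    rcases Nat.lt_or_ge (s + 1) p with hlt | hge
    · obtain rfl : p = s + 2 := by omega
      exact h0 (by omega)
    · rintro ⟨h1, h2⟩
      have hrec := leadMinor_add_two N s (by omega) (hcut _ hge (by omega))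
      rw [h2, h1, zero_mul, zero_sub, eq_comm, neg_eq_zero] at hrec
      have := (mul_eq_zero.1 hrec).resolve_left (hne s hge (by omega) (by omega))
      exact ih hge (by omega) (by omega) ⟨this, h1⟩

/-- The analogue of `leadMinor_consecutive` for trailing minors. -/
lemma trailMinor_consecutive [IsDomain R] (N : Matrix (Fin n) (Fin n) R) (p q : ℕ) (hqn : q ≤ n)
    (hcut : ∀ s, p ≤ s → s ≤ q → CutAt N s)
    (hne : ∀ s, p ≤ s + 1 → s + 1 ≤ q → ∀ h : s + 1 < n,
      N ⟨s, by omega⟩ ⟨s + 1, h⟩ * N ⟨s + 1, h⟩ ⟨s, by omega⟩ ≠ 0)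
    (h0 : q < n → ¬(trailMinor N q = 0 ∧ trailMinor N (q + 1) = 0)) (k s : ℕ) (hk : s + k = q)
    (hp : p ≤ s + 1) (hn : s < n) :
    ¬(trailMinor N s = 0 ∧ trailMinor N (s + 1) = 0) := by
  induction k generalizing s with
  | zero =>
    obtain rfl : s = q := by omega
    exact h0 hn
  | succ k ih =>
    rcases Nat.lt_or_ge (s + 1) n with hlt | hge
    · rintro ⟨h1, h2⟩
      have hrec := trailMinor_of_cutAt N s hlt (hcut _ hp (by omega))
      rw [h2, h1, mul_zero, zero_sub, eq_comm, neg_eq_zero] at hrec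
      have := (mul_eq_zero.1 hrec).resolve_left (hne s hp (by omega) hlt)
      exact ih (s + 1) (by omega) (by omega) hlt ⟨h2, this⟩
    · obtain rfl : n = s + 1 := by omega
      rw [trailMinor_self]
      simp

/-- For a singular matrix, the two complementary minors at a chain index vanish together. -/
lemma leadMinor_eq_zero_iff_trailMinor [IsDomain R] (N : Matrix (Fin n) (Fin n) R) (p q : ℕ)
    (hqn : q ≤ n) (hcut : ∀ s, p ≤ s → s ≤ q → CutAt N s)
    (hne : ∀ s, p ≤ s + 1 → s + 1 ≤ q → ∀ h : s + 1 < n,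
      N ⟨s, by omega⟩ ⟨s + 1, h⟩ * N ⟨s + 1, h⟩ ⟨s, by omega⟩ ≠ 0)
    (h0 : 0 < p → ¬(leadMinor N (p - 1) = 0 ∧ leadMinor N p = 0))
    (h1 : q < n → ¬(trailMinor N q = 0 ∧ trailMinor N (q + 1) = 0))
    (hdet : N.det = 0) (s : ℕ) (hp : p ≤ s) (hq : s < q) :
    leadMinor N s = 0 ↔ trailMinor N (s + 1) = 0 := by
  constructor
  · intro hs
    have hcons := leadMinor_consecutive N p q hcut hne h0 s (by omega) hq (by omega)
    rcases Nat.lt_or_ge (s + 1) n with hlt | hge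
    · have hD := det_eq_of_cutAt N s hlt (hcut _ (by omega) hq)
      rw [hdet, hs, zero_mul, mul_zero, sub_zero, eq_comm, mul_eq_zero] at hD
      exact hD.resolve_left fun h => hcons ⟨hs, h⟩
    · obtain rfl : n = s + 1 := by omega
      exact absurd ⟨hs, (leadMinor_self N).trans hdet⟩ hcons
  · intro hs
    have hcons := trailMinor_consecutive N p q hqn hcut hne h1 (q - s) s (by omega) (by omega)
      (by omega)
    rcases s with _ | s
    · exact absurd ⟨(trailMinor_zero N).trans hdet, hs⟩ hcons
    · have hD := det_eq_of_cutAt N s (by omega) (hcut _ hp (by omega))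
      rw [hdet, hs, mul_zero, mul_zero, sub_zero, eq_comm, mul_eq_zero] at hD
      exact hD.resolve_right fun h => hcons ⟨h, hs⟩

end Chains

section Isthmus

open Finset Matrix

variable {a m b d : ℕ} {M : Matrix (Fin (a + m + b)) (Fin (a + m + b)) ℝ}
  {f : Fin d → Fin (a + m + b)} {E : Fin d → ℝ}

lemma isthP_eq_leadMinor (s : ℕ) (z : Fin d → ℂ) (lam : ℂ) :
    isthP a m b d M f E s z lam = leadMinor (isthH a m b d M f E z - lam • 1) s :=
  Pminor_eq_leadMinor _ _

lemma isthQ_eq_trailMinor (s : ℕ) (z : Fin d → ℂ) (lam : ℂ) :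
    isthQ a m b d M f E s z lam = trailMinor (isthH a m b d M f E z - lam • 1) (s + 1) :=
  Qminor_eq_trailMinor _ _

lemma isthH_apply_congr (z w : Fin d → ℂ) (i i' : Fin (a + m + b))
    (h : ∀ j, f j = i → z j = w j) :
    isthH a m b d M f E z i i' = isthH a m b d M f E w i i' := by
  simp only [isthH, Matrix.of_apply]
  congr 2
  refine Finset.sum_congr rfl fun j _ => ?_
  split_ifs with hj
  · rw [h j hj]
  · rfl

/-- `P_s` depends on `z_j` only if `f j < s`. -/
lemma isthP_congr (s : ℕ) (z w : Fin d → ℂ) (lam : ℂ)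
    (h : ∀ j, (f j : ℕ) < s → z j = w j) :
    isthP a m b d M f E s z lam = isthP a m b d M f E s w lam := by
  rw [isthP, isthP, Pminor, Pminor]
  congr 1
  ext i i'
  simp only [submatrix_apply, Matrix.sub_apply]
  rw [isthH_apply_congr z w]
  intro j hj
  apply h
  rw [hj]
  exact lt_of_lt_of_le i.2 (min_le_left _ _)

/-- `Q_s` depends on `z_j` only if `f j > s`. -/
lemma isthQ_congr (s : ℕ) (z w : Fin d → ℂ) (lam : ℂ)
    (h : ∀ j, s < (f j : ℕ) → z j = w j) :
    isthQ a m b d M f E s z lam = isthQ a m b d M f E s w lam := by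
  rw [isthQ, isthQ, Qminor, Qminor]
  congr 1
  ext i i'
  simp only [submatrix_apply, Matrix.sub_apply]
  rw [isthH_apply_congr z w]
  intro j hj
  apply h
  rw [hj]
  simp only
  omega

lemma isthH_update (z : Fin d → ℂ) (j : Fin d) (t : ℂ) :
    isthH a m b d M f E (Function.update z j t) = isthH a m b d M f E z
      + diagonal (Pi.single (f j) ((E j : ℂ) * (t + t⁻¹) - (E j : ℂ) * (z j + (z j)⁻¹))) := by
  ext i i'
  by_cases hii : i = i'
  · subst hii
    simp only [isthH, of_apply, Matrix.add_apply, if_true, diagonal_apply_eq]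
    rw [add_assoc (M i i : ℂ)]
    congr 1
    rw [← Finset.add_sum_erase _ _ (mem_univ j),
      ← Finset.add_sum_erase univ (fun k => if f k = i then (E k : ℂ) * (z k + (z k)⁻¹) else 0)
        (mem_univ j)]
    have hrest : ∑ k ∈ univ.erase j, (if f k = i then (E k : ℂ) *
        (Function.update z j t k + (Function.update z j t k)⁻¹) else 0) =
        ∑ k ∈ univ.erase j, (if f k = i then (E k : ℂ) * (z k + (z k)⁻¹) else 0) := by
      refine Finset.sum_congr rfl fun k hk => ?_
      rw [Function.update_of_ne (Finset.ne_of_mem_erase hk)]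
    rw [hrest, Function.update_self]
    by_cases hi : f j = i
    · subst hi
      simp only [if_true, Pi.single_eq_same]
      ring
    · simp [hi]
  · simp [isthH, hii]

lemma cutAt_isthH (hMs : M.IsSymm)
    (hM0 : ∀ i j : Fin (a + m + b), (i : ℕ) < (j : ℕ) →
      ¬((j : ℕ) + 1 ≤ a) → ¬(a + m ≤ (i : ℕ)) →
      ¬((j : ℕ) = (i : ℕ) + 1 ∧ a ≤ (i : ℕ) + 1 ∧ (i : ℕ) ≤ a + m - 1) →
      M i j = 0) (z : Fin d → ℂ) (lam : ℂ) (s : ℕ) (hs : a ≤ s) (hs' : s ≤ a + m) :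
    CutAt (isthH a m b d M f E z - lam • 1) s := by
  intro i j hi hj
  by_cases h : i.val + 1 = s ∧ j.val = s
  · exact Or.inl h
  · right
    have h0 : M i j = 0 := hM0 i j (by omega) (by omega) (by omega) (by omega)
    have h0' : M j i = 0 := by rw [← h0]; exact hMs.apply i j
    have hij : i ≠ j := by
      rintro rfl
      omega
    simp [isthH, h0, h0', hij, hij.symm]

lemma isthD_update (z : Fin d → ℂ) (lam : ℂ) (j : Fin d) (t : ℂ)
    (hcut : CutAt (isthH a m b d M f E z - lam • 1) (f j)) :
    isthD a m b d M f E (Function.update z j t) lam = isthD a m b d M f E z lam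
      + ((E j : ℂ) * (t + t⁻¹) - (E j : ℂ) * (z j + (z j)⁻¹))
        * (isthP a m b d M f E (f j) z lam * isthQ a m b d M f E (f j) z lam) := by
  rw [isthD, isthH_update, add_sub_right_comm, det_add_diagonal_entry,
    maskDet_compl_singleton_of_cutAt _ _ hcut, isthP_eq_leadMinor, isthQ_eq_trailMinor, isthD]

lemma isthPD_eq (z : Fin d → ℂ) (lam : ℂ) (j : Fin d) (hz : z j ≠ 0)
    (hcut : CutAt (isthH a m b d M f E z - lam • 1) (f j)) :
    isthPD a m b d M f E j z lam = (E j : ℂ) * (1 - ((z j) ^ 2)⁻¹)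
        * (isthP a m b d M f E (f j) z lam * isthQ a m b d M f E (f j) z lam) := by
  rw [isthPD]
  simp_rw [isthD_update z lam j _ hcut]
  have h := ((((hasDerivAt_id (z j)).add (hasDerivAt_inv hz)).const_mul (E j : ℂ)).sub_const
    ((E j : ℂ) * (z j + (z j)⁻¹))).mul_const
      (isthP a m b d M f E (f j) z lam * isthQ a m b d M f E (f j) z lam)
  refine ((h.const_add (isthD a m b d M f E z lam)).congr_deriv ?_).deriv
  ring

/-- Pure second partial derivatives of `D`. -/
lemma isthPD2_self (z : Fin d → ℂ) (lam : ℂ) (j : Fin d) (hz : z j ≠ 0)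
    (hcut : ∀ w, CutAt (isthH a m b d M f E w - lam • 1) (f j)) :
    isthPD2 a m b d M f E j j z lam = 2 * ((z j)⁻¹) ^ 3 * (E j : ℂ)
        * isthP a m b d M f E (f j) z lam * isthQ a m b d M f E (f j) z lam := by
  rw [isthPD2]
  have hev : (fun s => isthPD a m b d M f E j (Function.update z j s) lam) =ᶠ[nhds (z j)]
      fun s => (E j : ℂ) * (1 - (s ^ 2)⁻¹)
        * (isthP a m b d M f E (f j) z lam * isthQ a m b d M f E (f j) z lam) := by
    filter_upwards [isOpen_ne.mem_nhds hz] with s hs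
    have hne : ∀ k, f k ≠ f j → Function.update z j s k = z k := fun k hk =>
      Function.update_of_ne (fun e => hk (congrArg f e)) _ _
    rw [isthPD_eq _ lam j (by simpa using hs) (hcut _), Function.update_self,
      isthP_congr (f j) (Function.update z j s) z lam
        (fun k hk => hne k fun e => by rw [e] at hk; exact lt_irrefl _ hk),
      isthQ_congr (f j) (Function.update z j s) z lam
        (fun k hk => hne k fun e => by rw [e] at hk; exact lt_irrefl _ hk)]
  rw [hev.deriv_eq]
  have h := (((((hasDerivAt_pow 2 (z j)).inv (pow_ne_zero 2 hz)).const_sub 1).const_mul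
    (E j : ℂ))).mul_const
      (isthP a m b d M f E (f j) z lam * isthQ a m b d M f E (f j) z lam)
  refine (h.congr_deriv ?_).deriv
  field_simp
  simp
  ring

/-- Mixed second partial derivatives of `D` vanish where `z_i = ±1`. -/
lemma isthPD2_of_ne (z : Fin d → ℂ) (lam : ℂ) (i j : Fin d) (hij : i ≠ j) (hz : z i ^ 2 = 1)
    (hcut : ∀ w, CutAt (isthH a m b d M f E w - lam • 1) (f i)) :
    isthPD2 a m b d M f E i j z lam = 0 := by
  have hz0 : z i ≠ 0 := by
    intro h
    simp [h] at hz
  have h0 : (fun s => isthPD a m b d M f E i (Function.update z j s) lam) = fun _ => 0 := by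
    funext s
    rw [isthPD_eq _ lam i (by rwa [Function.update_of_ne hij]) (hcut _),
      Function.update_of_ne hij, hz]
    simp
  rw [isthPD2, h0, deriv_const]

/-- If `P_s` and `Q_s` vanish together at the isthmus indices `s`, and `P_t`, `Q_u` have no common
root at corner points for `t ≤ u`, then no `P_s` vanishes at a critical point: cutting at the least
and the greatest vanishing index would produce a corner point with such a common root. -/
lemma isthP_ne_zero_of_critical (x : Fin d → ℂ) (lam : ℂ)
    (hf : ∀ j, a ≤ (f j : ℕ) ∧ (f j : ℕ) ≤ a + m - 1)
    (hG2 : ∀ x : Fin d → ℂ, (∀ j, x j = 1 ∨ x j = -1) →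
      ∀ t t' : ℕ, a ≤ t → t ≤ t' → t' ≤ a + m - 1 →
        ¬(isthP a m b d M f E t x lam = 0 ∧ isthQ a m b d M f E t' x lam = 0))
    (hPQ : ∀ s, a ≤ s → s ≤ a + m - 1 →
      (isthP a m b d M f E s x lam = 0 ↔ isthQ a m b d M f E s x lam = 0))
    (hcrit : ∀ j, isthP a m b d M f E (f j) x lam ≠ 0 → x j ^ 2 = 1)
    (s : ℕ) (hs : a ≤ s) (hs' : s ≤ a + m - 1) :
    isthP a m b d M f E s x lam ≠ 0 := by
  intro h0
  let Z : Finset ℕ := (Finset.Icc a (a + m - 1)).filter fun t => isthP a m b d M f E t x lam = 0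
  have hZ : Z.Nonempty := ⟨s, by simp [Z, hs, hs', h0]⟩
  have hmin := Z.min'_mem hZ
  have hmax := Z.max'_mem hZ
  have hle := Z.min'_le_max' hZ
  have hlow : ∀ t ∈ Z, Z.min' hZ ≤ t := fun t ht => Z.min'_le t ht
  have hhigh : ∀ t ∈ Z, t ≤ Z.max' hZ := fun t ht => Z.le_max' t ht
  set t := Z.min' hZ
  set t' := Z.max' hZ
  simp only [Z, mem_filter, Finset.mem_Icc] at hmin hmax
  have hout : ∀ j, (f j : ℕ) < t ∨ t' < (f j : ℕ) → x j ^ 2 = 1 := by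
    intro j hj
    apply hcrit
    intro h
    have hmem : (f j : ℕ) ∈ Z := by simp [Z, (hf j).1, (hf j).2, h]
    have := hlow _ hmem
    have := hhigh _ hmem
    omega
  let y : Fin d → ℂ := fun j => if (f j : ℕ) < t ∨ t' < (f j : ℕ) then x j else 1
  refine hG2 y ?_ t t' hmin.1.1 hle hmax.1.2 ⟨?_, ?_⟩
  · intro j
    by_cases hj : (f j : ℕ) < t ∨ t' < (f j : ℕ)
    · simpa [y, hj] using sq_eq_one_iff.1 (hout j hj)
    · simp [y, hj]
  · rw [isthP_congr t y x lam fun j hj => by simp [y, hj]]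
    exact hmin.2
  · rw [isthQ_congr t' y x lam fun j hj => by simp [y, hj]]
    exact (hPQ t' hmax.1.1 hmax.1.2).1 hmax.2

end Isthmus

/-- In the isthmus setting with generic parameters, at every critical point `(x,λ₀)` of `D`
(necessarily a corner point), the mixed second partials vanish, the pure second partials are
`2·x_j⁻³·E_j·P_{f(j)}(x,λ₀)·Q_{f(j)}(x,λ₀) ≠ 0`, and the Hessian matrix is an invertible
diagonal matrix: `(x,λ₀)` is a nondegenerate critical point. -/
theorem stmt_9 (a b m d : ℕ) (hm : 1 ≤ m) (hd : 1 ≤ d)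
    (M : Matrix (Fin (a + m + b)) (Fin (a + m + b)) ℝ)
    (hMs : M.IsSymm)
    -- zero pattern of M
    (hM0 : ∀ i j : Fin (a + m + b), (i : ℕ) < (j : ℕ) →
      ¬((j : ℕ) + 1 ≤ a) → ¬(a + m ≤ (i : ℕ)) →
      ¬((j : ℕ) = (i : ℕ) + 1 ∧ a ≤ (i : ℕ) + 1 ∧ (i : ℕ) ≤ a + m - 1) →
      M i j = 0)
    (f : Fin d → Fin (a + m + b))
    (hf : ∀ j, a ≤ (f j : ℕ) ∧ (f j : ℕ) ≤ a + m - 1)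
    (E : Fin d → ℝ)
    -- (G1) the consecutive entries M_{i,i+1}, a−1 ≤ i ≤ a+m−1, and all E_j are nonzero
    (hG1M : ∀ i : ℕ, a ≤ i + 1 → i ≤ a + m - 1 → ∀ h : i + 1 < a + m + b,
      M ⟨i, by omega⟩ ⟨i + 1, h⟩ ≠ 0)
    (hG1E : ∀ j, E j ≠ 0)
    -- (G2) at corner points, P_t and Q_{t'} (t ≤ t' isthmus indices) have no common root,
    -- and neither has a root in common with D
    (hG2 : ∀ x : Fin d → ℂ, (∀ j, x j = 1 ∨ x j = -1) →
      ∀ t t' : ℕ, a ≤ t → t ≤ t' → t' ≤ a + m - 1 → ∀ lam : ℂ,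
        (¬(isthP a m b d M f E t x lam = 0 ∧ isthQ a m b d M f E t' x lam = 0)) ∧
        (isthD a m b d M f E x lam = 0 →
          isthP a m b d M f E t x lam ≠ 0 ∧ isthQ a m b d M f E t' x lam ≠ 0))
    -- (G3) the boundary minors have no common roots
    (hG3a : 0 < a → ∀ (x : Fin d → ℂ) (lam : ℂ),
      ¬(isthP a m b d M f E (a - 1) x lam = 0 ∧ isthP a m b d M f E a x lam = 0))
    (hG3b : 0 < b → ∀ (x : Fin d → ℂ) (lam : ℂ),
      ¬(isthQ a m b d M f E (a + m - 1) x lam = 0 ∧ isthQ a m b d M f E (a + m) x lam = 0)) :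
    ∀ (x : Fin d → ℂ) (lam0 : ℂ), (∀ j, x j ≠ 0) →
      isthD a m b d M f E x lam0 = 0 →
      (∀ j, isthPD a m b d M f E j x lam0 = 0) →
      -- x is necessarily a corner point
      (∀ j, (x j) ^ 2 = 1) ∧
      -- the mixed second partials vanish
      (∀ i j : Fin d, i ≠ j → isthPD2 a m b d M f E i j x lam0 = 0) ∧
      -- the pure second partials are 2·x_j⁻³·E_j·P_{f(j)}·Q_{f(j)} ≠ 0
      (∀ j : Fin d,
        isthPD2 a m b d M f E j j x lam0
          = 2 * ((x j)⁻¹) ^ 3 * (E j : ℂ)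
              * isthP a m b d M f E (f j : ℕ) x lam0
              * isthQ a m b d M f E (f j : ℕ) x lam0 ∧
        isthPD2 a m b d M f E j j x lam0 ≠ 0) ∧
      -- the Hessian is an invertible (diagonal) matrix
      IsUnit (Matrix.of fun i j : Fin d => isthPD2 a m b d M f E i j x lam0) := by
  intro x lam0 hx hD hcrit
  have hcut : ∀ (z : Fin d → ℂ) (s : ℕ), a ≤ s → s ≤ a + m →
      CutAt (isthH a m b d M f E z - lam0 • 1) s :=
    fun z s hs hs' => cutAt_isthH hMs hM0 z lam0 s hs hs'
  have hcutf : ∀ (j : Fin d) (z : Fin d → ℂ),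
      CutAt (isthH a m b d M f E z - lam0 • 1) (f j) := fun j z =>
    hcut z _ (hf j).1 (by have := (hf j).2; omega)
  have hne : ∀ s, a ≤ s + 1 → s + 1 ≤ a + m → ∀ h : s + 1 < a + m + b,
      (isthH a m b d M f E x - lam0 • 1) ⟨s, by omega⟩ ⟨s + 1, h⟩
        * (isthH a m b d M f E x - lam0 • 1) ⟨s + 1, h⟩ ⟨s, by omega⟩ ≠ 0 := by
    intro s hs hs' h
    have hM := hG1M s hs (by omega) h
    have hM' : M ⟨s + 1, h⟩ ⟨s, by omega⟩ ≠ 0 := by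
      rwa [hMs.apply]
    simpa [isthH] using ⟨hM, hM'⟩
  have hPQ : ∀ s, a ≤ s → s ≤ a + m - 1 →
      (isthP a m b d M f E s x lam0 = 0 ↔ isthQ a m b d M f E s x lam0 = 0) := by
    intro s hs hs'
    rw [isthP_eq_leadMinor, isthQ_eq_trailMinor]
    refine leadMinor_eq_zero_iff_trailMinor _ a (a + m) (by omega) (hcut x) hne ?_ ?_ hD s hs
      (by omega)
    · intro ha
      have := hG3a ha x lam0
      rwa [isthP_eq_leadMinor, isthP_eq_leadMinor] at this
    · intro hb
      have := hG3b (by omega) x lam0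
      rwa [isthQ_eq_trailMinor, isthQ_eq_trailMinor, Nat.sub_add_cancel (by omega)] at this
  have hEc : ∀ j, (E j : ℂ) ≠ 0 := fun j => Complex.ofReal_ne_zero.2 (hG1E j)
  have hQf : ∀ j, isthP a m b d M f E (f j) x lam0 ≠ 0 →
      isthQ a m b d M f E (f j) x lam0 ≠ 0 := fun j =>
    mt (hPQ _ (hf j).1 (hf j).2).2
  have hsq : ∀ j, isthP a m b d M f E (f j) x lam0 ≠ 0 → x j ^ 2 = 1 := by
    intro j hj
    have h := hcrit j
    rw [isthPD_eq x lam0 j (hx j) (hcutf j x)] at h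
    have h1 : 1 - (x j ^ 2)⁻¹ = 0 := by
      simpa [hEc j, hj, hQf j hj] using h
    exact inv_eq_one.1 (sub_eq_zero.1 h1).symm
  have hP : ∀ j, isthP a m b d M f E (f j) x lam0 ≠ 0 := fun j =>
    isthP_ne_zero_of_critical x lam0 hf
      (fun y hy t t' ht htt ht' => (hG2 y hy t t' ht htt ht' lam0).1) hPQ hsq _ (hf j).1 (hf j).2
  have hcorner : ∀ j, x j ^ 2 = 1 := fun j => hsq j (hP j)
  have hmixed : ∀ i j : Fin d, i ≠ j → isthPD2 a m b d M f E i j x lam0 = 0 := fun i j hij =>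
    isthPD2_of_ne x lam0 i j hij (hcorner i) (hcutf i)
  have hpure := fun j => isthPD2_self x lam0 j (hx j) (hcutf j)
  have hpure_ne : ∀ j, isthPD2 a m b d M f E j j x lam0 ≠ 0 := by
    intro j
    rw [hpure j]
    exact mul_ne_zero (mul_ne_zero (mul_ne_zero (mul_ne_zero two_ne_zero
      (pow_ne_zero 3 (inv_ne_zero (hx j)))) (hEc j)) (hP j)) (hQf j (hP j))
  refine ⟨hcorner, hmixed, fun j => ⟨hpure j, hpure_ne j⟩, ?_⟩
  have hdiag : (Matrix.of fun i j : Fin d => isthPD2 a m b d M f E i j x lam0)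
      = Matrix.diagonal fun j => isthPD2 a m b d M f E j j x lam0 := by
    ext i j
    by_cases hij : i = j
    · subst hij
      simp
    · simp [hij, hmixed i j hij]
  rw [hdiag, Matrix.isUnit_iff_isUnit_det, Matrix.det_diagonal, isUnit_iff_ne_zero]
  exact Finset.prod_ne_zero_iff.2 fun j _ => hpure_ne j
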